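/- For every finite connected simple port-labeled graph G with n vertices and m edges and every root vertex v_R, the port-DFS traversal of G from v_R halts at v_R after at most 4·m moves, and at the moment it halts every vertex of G has been visited (added to the set S). -/

import Mathlib

open scoped Classical

/-- Direction of a move of the port-DFS traversal. -/
inductive PDir : Type where
  | fwd : PDir
  | bwd : PDir
deriving DecidableEq

/-- Position of the port-DFS walk: before the first move (`start`, at the root),
having just arrived at `cur` via in-port `inPort` with direction `dir` (`moving`),
or halted at a vertex. -/
inductive PPos (V : Type) : Type where
  | start : PPos V
  | moving : V → ℕ → PDir → PPos V
  | halted : V → PPos V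

/-- Full state of the port-DFS traversal: position, set `S` of visited vertices,
and parent-port assignment `par`. -/
structure PState (V : Type) : Type where
  pos : PPos V
  vis : Finset V
  par : V → ℕ

/-- A finite connected simple port-labeled graph: for every vertex `u` of degree
`deg u`, the edges incident to `u` are labeled by distinct ports `0, …, deg u - 1`;
`port u v` is the port at `u` of the edge `{u, v}`. -/
structure PortedGraph (V : Type) [Fintype V] [DecidableEq V] : Type where
  G : SimpleGraph V
  conn : G.Connected
  deg : V → ℕ
  port : V → V → ℕ
  port_lt : ∀ {u v : V}, G.Adj u v → port u v < deg u
  port_inj : ∀ {u v w : V}, G.Adj u v → G.Adj u w → port u v = port u w → v = w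
  port_surj : ∀ {u : V} (p : ℕ), p < deg u → ∃ v : V, G.Adj u v ∧ port u v = p

namespace PortedGraph

variable {V : Type} [Fintype V] [DecidableEq V]

/-- The neighbor of `u` reached from `u` through port `p`. -/
noncomputable def dest (P : PortedGraph V) (u : V) (p : ℕ) : V :=
  if h : ∃ v : V, P.G.Adj u v ∧ P.port u v = p then h.choose else u

/-- One step of the port-DFS traversal from root `vR`.  A state with
`pos = moving v q d` means the walk has just arrived at `v` via port `q` (at `v`)
with direction `d`, and `vis`/`par` are the data from before processing this
arrival; the step processes the arrival according to rules (i)–(v) and performs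
the next move (or halts). -/
noncomputable def step (P : PortedGraph V) (vR : V) (s : PState V) : PState V :=
  match s.pos with
  | PPos.start =>
      if 0 < P.deg vR then
        { pos := PPos.moving (P.dest vR 0) (P.port (P.dest vR 0) vR) PDir.fwd,
          vis := s.vis, par := s.par }
      else
        { pos := PPos.halted vR, vis := s.vis, par := s.par }
  | PPos.halted v => { pos := PPos.halted v, vis := s.vis, par := s.par }
  | PPos.moving v q PDir.fwd =>
      if v ∈ s.vis then
        -- rule (ii): leave via `q` with direction backward
        { pos := PPos.moving (P.dest v q) (P.port (P.dest v q) v) PDir.bwd,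
          vis := s.vis, par := s.par }
      else
        -- rule (i): add `v` to `S`, set `par v := q`, leave via `(q+1) % deg v`
        { pos := PPos.moving (P.dest v ((q + 1) % P.deg v))
            (P.port (P.dest v ((q + 1) % P.deg v)) v)
            (if (q + 1) % P.deg v = q then PDir.bwd else PDir.fwd),
          vis := insert v s.vis, par := Function.update s.par v q }
  | PPos.moving v q PDir.bwd =>
      if v ≠ vR ∧ (q + 1) % P.deg v = s.par v then
        -- rule (iii): leave via the parent port with direction backward
        { pos := PPos.moving (P.dest v (s.par v)) (P.port (P.dest v (s.par v)) v) PDir.bwd,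
          vis := s.vis, par := s.par }
      else if v = vR ∧ (q + 1) % P.deg v = 0 then
        -- rule (iv): halt
        { pos := PPos.halted v, vis := s.vis, par := s.par }
      else
        -- rule (v): leave via `(q+1) % deg v` with direction forward
        { pos := PPos.moving (P.dest v ((q + 1) % P.deg v))
            (P.port (P.dest v ((q + 1) % P.deg v)) v) PDir.fwd,
          vis := s.vis, par := s.par }

/-- The trace of the port-DFS traversal from `vR`:  `trace P vR t` is the state
after `t` transitions; every transition except those into/out of a halted
position is a move along an edge. -/
noncomputable def trace (P : PortedGraph V) (vR : V) : ℕ → PState V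
  | 0 => { pos := PPos.start, vis := {vR}, par := fun _ => 0 }
  | t + 1 => P.step vR (P.trace vR t)

/-- The first time at which `k` distinct vertices have been visited; the
`k`-stopped traversal is the traversal halted at that moment (at which point the
walk, having made `stopTime - 1` moves, stands at the `k`-th visited vertex). -/
noncomputable def stopTime (P : PortedGraph V) (vR : V) (k : ℕ) : ℕ :=
  sInf {t : ℕ | k ≤ ((P.trace vR t).vis).card}

/-- `V'`: the set of vertices visited by the `k`-stopped traversal. -/
noncomputable def visitedBy (P : PortedGraph V) (vR : V) (k : ℕ) : Finset V :=
  (P.trace vR (P.stopTime vR k)).vis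

/-- `V'` as a set. -/
noncomputable def Vset (P : PortedGraph V) (vR : V) (k : ℕ) : Set V :=
  ↑(P.visitedBy vR k)

/-- The parent-port assignment at the end of the `k`-stopped traversal. -/
noncomputable def parFinal (P : PortedGraph V) (vR : V) (k : ℕ) : V → ℕ :=
  (P.trace vR (P.stopTime vR k)).par

/-- `u(v)`: the neighbor of `v` reached from `v` through its parent port. -/
noncomputable def parentVert (P : PortedGraph V) (vR : V) (k : ℕ) (v : V) : V :=
  P.dest v (P.parFinal vR k v)

/-- `v_L`: the `k`-th (last) vertex added to `S` by the `k`-stopped traversal. -/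
noncomputable def lastVert (P : PortedGraph V) (vR : V) (k : ℕ) : V :=
  if h : ∃ v : V, v ∈ P.visitedBy vR k ∧ v ∉ (P.trace vR (P.stopTime vR k - 1)).vis
  then h.choose else vR

/-- The tree `T` of parent edges `{v, u(v)}`, `v ∈ V' \ {v_R}`, as a graph on `V`
(vertices outside `V'` are isolated). -/
noncomputable def treeRel (P : PortedGraph V) (vR : V) (k : ℕ) : SimpleGraph V :=
  SimpleGraph.fromRel (fun a b =>
    a ∈ P.visitedBy vR k ∧ a ≠ vR ∧ b = P.parentVert vR k a)

/-- The tree `T` of parent edges as a graph on the vertex set `V'`. -/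
noncomputable def treeSub (P : PortedGraph V) (vR : V) (k : ℕ) :
    SimpleGraph (P.Vset vR k) :=
  SimpleGraph.fromRel (fun a b => (a : V) ≠ vR ∧ (b : V) = P.parentVert vR k (a : V))

/-- `v` lies on the rootpath: the unique path in `T` from `v_R` to `v_L`. -/
def onRootpath (P : PortedGraph V) (vR : V) (k : ℕ) (v : V) : Prop :=
  ∃ p : (P.treeRel vR k).Walk vR (P.lastVert vR k), p.IsPath ∧ v ∈ p.support

/-- The move made out of state `s`:  `some (v, p, d)` if the walk leaves vertex
`v` via port `p` with direction `d`, and `none` if it halts (or already halted). -/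
noncomputable def exitEvent (P : PortedGraph V) (vR : V) (s : PState V) :
    Option (V × ℕ × PDir) :=
  match s.pos with
  | PPos.start => if 0 < P.deg vR then some (vR, 0, PDir.fwd) else none
  | PPos.halted _ => none
  | PPos.moving v q PDir.fwd =>
      if v ∈ s.vis then some (v, q, PDir.bwd)
      else some (v, (q + 1) % P.deg v,
        if (q + 1) % P.deg v = q then PDir.bwd else PDir.fwd)
  | PPos.moving v q PDir.bwd =>
      if v ≠ vR ∧ (q + 1) % P.deg v = s.par v then some (v, s.par v, PDir.bwd)
      else if v = vR ∧ (q + 1) % P.deg v = 0 then none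
      else some (v, (q + 1) % P.deg v, PDir.fwd)

end PortedGraph

namespace PortedGraph

variable {V : Type} [Fintype V] [DecidableEq V]

theorem adj_dest (P : PortedGraph V) {u : V} {p : ℕ} (hp : p < P.deg u) :
    P.G.Adj u (P.dest u p) := by
  have h := P.port_surj p hp
  rw [dest, dif_pos h]
  exact h.choose_spec.1

theorem port_dest (P : PortedGraph V) {u : V} {p : ℕ} (hp : p < P.deg u) :
    P.port u (P.dest u p) = p := by
  have h := P.port_surj p hp
  rw [dest, dif_pos h]
  exact h.choose_spec.2

theorem dest_port (P : PortedGraph V) {u v : V} (h : P.G.Adj u v) :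
    P.dest u (P.port u v) = v :=
  P.port_inj (P.adj_dest (P.port_lt h)) h (P.port_dest (P.port_lt h))

theorem deg_le_degree (P : PortedGraph V) (v : V) : P.deg v ≤ P.G.degree v := by
  rw [← Finset.card_range (P.deg v), ← SimpleGraph.card_neighborFinset_eq_degree]
  refine Finset.card_le_card_of_injOn (P.dest v) (fun p hp => ?_) (fun p hp p' hp' h => ?_)
  · simpa using P.adj_dest (by simpa using hp)
  · rw [← P.port_dest (u := v) (p := p) (by simpa using hp), h, P.port_dest (by simpa using hp')]

theorem sum_deg_le (P : PortedGraph V) : ∑ v, P.deg v ≤ 2 * P.G.edgeSet.ncard := by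
  rw [← SimpleGraph.coe_edgeFinset, Set.ncard_coe_finset, ← P.G.sum_degrees_eq_twice_card_edges]
  exact Finset.sum_le_sum fun v _ => P.deg_le_degree v

/-- The state in which the walk has just left `u` via port `p` with direction `d`. -/
noncomputable def leave (P : PortedGraph V) (u : V) (p : ℕ) (d : PDir) (S : Finset V)
    (par : V → ℕ) : PState V :=
  ⟨PPos.moving (P.dest u p) (P.port (P.dest u p) u) d, S, par⟩

theorem leave_port (P : PortedGraph V) {u : V} {p : ℕ} (hp : p < P.deg u) (d : PDir)
    (S : Finset V) (par : V → ℕ) :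
    P.leave (P.dest u p) (P.port (P.dest u p) u) d S par = ⟨PPos.moving u p d, S, par⟩ := by
  rw [leave, P.dest_port (P.adj_dest hp).symm, P.port_dest hp]

/-- The traversal leads from `s` to `s'`, keeping the parent ports of the vertices visited in `s`;
every neighbor of a vertex visited on the way is visited in `s'`, and the number of transitions is
at most `c` plus twice the total degree of the vertices visited on the way. -/
def Explores (P : PortedGraph V) (vR : V) (s s' : PState V) (c : ℤ) : Prop :=
  s.vis ⊆ s'.vis ∧ (∀ w ∈ s.vis, s'.par w = s.par w) ∧
    (∀ w ∈ s'.vis, w ∉ s.vis → ∀ x, P.G.Adj w x → x ∈ s'.vis) ∧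
    ∃ t : ℕ, (P.step vR)^[t] s = s' ∧
      (t : ℤ) + 2 * ∑ w ∈ s.vis, (P.deg w : ℤ) ≤ c + 2 * ∑ w ∈ s'.vis, (P.deg w : ℤ)

theorem Explores.refl (P : PortedGraph V) (vR : V) (s : PState V) : P.Explores vR s s 0 :=
  ⟨subset_rfl, fun _ _ => rfl, fun _ h h' => absurd h h', 0, rfl, by simp⟩

theorem Explores.trans {P : PortedGraph V} {vR : V} {s s' s'' : PState V} {c c' : ℤ}
    (h : P.Explores vR s s' c) (h' : P.Explores vR s' s'' c') :
    P.Explores vR s s'' (c + c') := by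
  obtain ⟨hsub, hpar, hcl, t, ht, hc⟩ := h
  obtain ⟨hsub', hpar', hcl', t', ht', hc'⟩ := h'
  refine ⟨hsub.trans hsub', fun w hw => (hpar' w (hsub hw)).trans (hpar w hw),
    fun w hw hw' x hx => ?_, t' + t, ?_, ?_⟩
  · by_cases hws : w ∈ s'.vis
    · exact hsub' (hcl w hws hw' x hx)
    · exact hcl' w hw hws x hx
  · rw [Function.iterate_add_apply, ht, ht']
  · push_cast
    linarith

theorem Explores.mono {P : PortedGraph V} {vR : V} {s s' : PState V} {c c' : ℤ}
    (h : P.Explores vR s s' c) (hc : c ≤ c') : P.Explores vR s s' c' := by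
  obtain ⟨h₁, h₂, h₃, t, ht, hle⟩ := h
  exact ⟨h₁, h₂, h₃, t, ht, by linarith⟩

theorem explores_of_step {P : PortedGraph V} {vR : V} {s s' : PState V} (h : P.step vR s = s')
    (hvis : s'.vis = s.vis) (hpar : s'.par = s.par) : P.Explores vR s s' 1 :=
  ⟨hvis.ge, fun _ _ => by rw [hpar], fun _ hw hw' => absurd (hvis ▸ hw) hw', 1, h, by simp [hvis]⟩

/-- Entering an unvisited vertex `v` forward from a visited one, the walk eventually leaves `v`
backward via the port of entry. -/
def ToursNew (P : PortedGraph V) (vR : V) (S : Finset V) : Prop :=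
  ∀ (par : V → ℕ) (v : V) (q : ℕ), v ∉ S → q < P.deg v → P.dest v q ∈ S →
    ∃ S' par', v ∈ S' ∧
      P.Explores vR ⟨PPos.moving v q PDir.fwd, S, par⟩ (P.leave v q PDir.bwd S' par') (-1)

theorem ToursNew.probe {P : PortedGraph V} {vR : V} {S : Finset V} (hS : P.ToursNew vR S)
    (par : V → ℕ) {u : V} {p : ℕ} (hu : u ∈ S) (hp : p < P.deg u) :
    ∃ S' par', P.dest u p ∈ S' ∧
      P.Explores vR (P.leave u p PDir.fwd S par) ⟨PPos.moving u p PDir.bwd, S', par'⟩ 1 := by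
  have hadj := (P.adj_dest hp).symm
  by_cases hv : P.dest u p ∈ S
  · refine ⟨S, par, hv, explores_of_step ?_ rfl rfl⟩
    rw [← P.leave_port hp]
    simp [step, leave, hv]
  · obtain ⟨S', par', hv', h⟩ := hS par _ _ hv (P.port_lt hadj) (by rwa [P.dest_port hadj])
    rw [P.leave_port hp] at h
    exact ⟨S', par', hv', h.mono (by norm_num)⟩

/-- The port at which the walk stops scanning the ports of `u`. -/
def lastPort (vR : V) (par : V → ℕ) (u : V) : ℕ := if u = vR then 0 else par u

theorem step_bwd_of_ne (P : PortedGraph V) {vR u : V} {q : ℕ} {S : Finset V} {par : V → ℕ}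
    (h : (q + 1) % P.deg u ≠ lastPort vR par u) :
    P.step vR ⟨PPos.moving u q PDir.bwd, S, par⟩ =
      P.leave u ((q + 1) % P.deg u) PDir.fwd S par := by
  by_cases hu : u = vR
  · subst hu
    simp_all [step, leave, lastPort]
  · simp_all [step, leave, lastPort]

theorem explores_ports {P : PortedGraph V} {vR u : V} {S₀ : Finset V}
    (hS : ∀ S, S₀ ⊆ S → P.ToursNew vR S) (k : ℕ) :
    ∀ (q : ℕ) (S : Finset V) (par : V → ℕ), S₀ ⊆ S → u ∈ S → k < P.deg u →
      (q + 1 + k) % P.deg u = lastPort vR par u →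
      ∃ q' S' par', (q' + 1) % P.deg u = lastPort vR par u ∧
        (∀ i < k, P.dest u ((q + 1 + i) % P.deg u) ∈ S') ∧
        P.Explores vR ⟨PPos.moving u q PDir.bwd, S, par⟩
          ⟨PPos.moving u q' PDir.bwd, S', par'⟩ (2 * k) := by
  induction k with
  | zero =>
    intro q S par _ _ _ he
    exact ⟨q, S, par, he, by simp, by simpa using Explores.refl P vR _⟩
  | succ k ih =>
    intro q S par hS₀ hu hk he
    have hne : (q + 1) % P.deg u ≠ lastPort vR par u := by
      rw [← he]
      intro h
      have h' : q + 1 + 0 ≡ q + 1 + (k + 1) [MOD P.deg u] := h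
      have := (Nat.ModEq.add_left_cancel' _ h').eq_of_lt_of_lt (by omega) hk
      omega
    have hp : (q + 1) % P.deg u < P.deg u := Nat.mod_lt _ (by omega)
    have hstep : P.Explores vR ⟨PPos.moving u q PDir.bwd, S, par⟩ _ 1 :=
      explores_of_step (P.step_bwd_of_ne hne) rfl rfl
    obtain ⟨S₁, par₁, hd, h₁⟩ := (hS S hS₀).probe par hu hp
    have hsub : S ⊆ S₁ := h₁.1
    have hpar : lastPort vR par₁ u = lastPort vR par u := by
      have : par₁ u = par u := h₁.2.1 u hu
      simp [lastPort, this]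
    have hmod (i : ℕ) : ((q + 1) % P.deg u + 1 + i) % P.deg u = (q + 1 + (i + 1)) % P.deg u := by
      rw [add_assoc, Nat.mod_add_mod, add_comm 1 i]
    obtain ⟨q', S', par', hq', hd', h₂⟩ := ih ((q + 1) % P.deg u) S₁ par₁ (hS₀.trans hsub)
      (hsub hu) (by omega) (by rw [hmod, he, hpar])
    refine ⟨q', S', par', hq'.trans hpar, ?_,
      ((hstep.trans h₁).trans h₂).mono (by push_cast; linarith)⟩
    rintro (_ | i) hi
    · exact h₂.1 hd
    · rw [← hmod]
      exact hd' i (by omega)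

theorem exists_add_mod_eq {d a p : ℕ} (hp : p < d) : ∃ i < d, (a + i) % d = p := by
  have hd : 0 < d := by omega
  have ha := Nat.mod_lt a hd
  refine ⟨(p + (d - a % d)) % d, Nat.mod_lt _ hd, ?_⟩
  rw [Nat.add_mod_mod, ← Nat.mod_add_mod, show a % d + (p + (d - a % d)) = p + d by omega,
    Nat.add_mod_right, Nat.mod_eq_of_lt hp]

/-- Scanning all ports of `u` but the last one, starting from port `p`. -/
theorem explores_from_port {P : PortedGraph V} {vR u : V} {S : Finset V}
    (hS : ∀ S', S ⊆ S' → P.ToursNew vR S') (par : V → ℕ) (hu : u ∈ S) {p k : ℕ}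
    (hp : p < P.deg u) (hk : k < P.deg u) (he : (p + 1 + k) % P.deg u = lastPort vR par u) :
    ∃ q' S' par', (q' + 1) % P.deg u = lastPort vR par u ∧
      (∀ i < k + 1, P.dest u ((p + i) % P.deg u) ∈ S') ∧
      P.Explores vR (P.leave u p PDir.fwd S par)
        ⟨PPos.moving u q' PDir.bwd, S', par'⟩ (2 * k + 1) := by
  obtain ⟨S₁, par₁, hd, h₁⟩ := (hS S subset_rfl).probe par hu hp
  have hsub : S ⊆ S₁ := h₁.1
  have hpar : lastPort vR par₁ u = lastPort vR par u := by
    have : par₁ u = par u := h₁.2.1 u hu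
    simp [lastPort, this]
  obtain ⟨q', S', par', hq', hd', h₂⟩ := explores_ports hS k p S₁ par₁ hsub (hsub hu) hk
    (he.trans hpar.symm)
  refine ⟨q', S', par', hq'.trans hpar, ?_, (h₁.trans h₂).mono (by linarith)⟩
  rintro (_ | i) hi
  · rw [add_zero, Nat.mod_eq_of_lt hp]
    exact h₂.1 hd
  · rw [add_comm i, ← add_assoc]
    exact hd' i (by omega)

/-- Combining the arrival at an unvisited vertex with the exploration that follows it. -/
theorem Explores.of_insert {P : PortedGraph V} {vR v : V} {s s₁ s' : PState V} {c : ℤ}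
    (h : P.Explores vR s₁ s' c) (hv : v ∉ s.vis) (hstep : P.step vR s = s₁)
    (hvis : s₁.vis = insert v s.vis) (hpar : ∀ w ∈ s.vis, s₁.par w = s.par w)
    (hcl : ∀ x, P.G.Adj v x → x ∈ s'.vis) : P.Explores vR s s' (c + 1 - 2 * P.deg v) := by
  obtain ⟨h₁, h₂, h₃, t, ht, hc⟩ := h
  rw [hvis] at h₁ h₂ h₃ hc
  rw [Finset.sum_insert hv] at hc
  refine ⟨(Finset.subset_insert _ _).trans h₁,
    fun w hw => (h₂ w (Finset.mem_insert_of_mem hw)).trans (hpar w hw), fun w hw hw' => ?_,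
    t + 1, by rw [Function.iterate_succ_apply, hstep, ht], by push_cast; linarith⟩
  by_cases hwv : w = v
  · exact hwv ▸ hcl
  · exact h₃ w hw (by simp [hwv, hw'])

theorem toursNew (P : PortedGraph V) (vR : V) (S : Finset V) (hR : vR ∈ S) :
    P.ToursNew vR S := by
  induction hn : (Finset.univ \ S).card using Nat.strong_induction_on generalizing S with
  | _ n ih =>
  intro par v q hv hq hd
  have hvR : v ≠ vR := fun h => hv (h ▸ hR)
  have hS (S' : Finset V) (hS' : insert v S ⊆ S') : P.ToursNew vR S' := by
    refine ih _ ?_ S' (hS' (Finset.mem_insert_of_mem hR)) rfl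
    rw [← hn]
    refine Finset.card_lt_card (Finset.ssubset_iff_of_subset
      (Finset.sdiff_subset_sdiff subset_rfl ((Finset.subset_insert v S).trans hS')) |>.2
      ⟨v, by simp [hv], ?_⟩)
    simp [hS' (Finset.mem_insert_self v S)]
  have hupd (w : V) (hw : w ∈ S) : Function.update par v q w = par w :=
    Function.update_of_ne (by rintro rfl; exact hv hw) _ _
  by_cases hdeg : P.deg v = 1
  · refine ⟨insert v S, Function.update par v q, Finset.mem_insert_self _ _, ?_⟩
    have hq0 : q = 0 := by omega
    have hstep : P.step vR ⟨PPos.moving v q PDir.fwd, S, par⟩ =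
        P.leave v q PDir.bwd (insert v S) (Function.update par v q) := by
      simp [step, leave, hv, hdeg, hq0]
    refine ((Explores.refl P vR _).of_insert hv hstep rfl hupd fun x hx => ?_).mono (by simp [hdeg])
    have := P.port_lt hx
    rw [← P.dest_port hx, show P.port v x = q by omega]
    exact Finset.mem_insert_of_mem hd
  · have hne : (q + 1) % P.deg v ≠ q := by
      intro h
      rcases Nat.lt_or_ge (q + 1) (P.deg v) with h' | h'
      · rw [Nat.mod_eq_of_lt h'] at h
        omega
      · rw [show q + 1 = P.deg v by omega, Nat.mod_self] at h
        omega
    have hstep : P.step vR ⟨PPos.moving v q PDir.fwd, S, par⟩ =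
        P.leave v ((q + 1) % P.deg v) PDir.fwd (insert v S) (Function.update par v q) := by
      simp [step, leave, hv, hne]
    have hlast : lastPort vR (Function.update par v q) v = q := by simp [lastPort, hvR]
    obtain ⟨q', S', par', hq', hd', h⟩ := explores_from_port (k := P.deg v - 2) hS
      (Function.update par v q) (Finset.mem_insert_self v S)
      (Nat.mod_lt (q + 1) (by omega)) (by omega) (by
        rw [hlast, add_assoc, Nat.mod_add_mod,
          show q + 1 + (1 + (P.deg v - 2)) = q + P.deg v by omega, Nat.add_mod_right,
          Nat.mod_eq_of_lt hq])
    rw [hlast] at hq'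
    have hpar' : par' v = q := by
      simpa [leave] using h.2.1 v (Finset.mem_insert_self v S)
    have hexit : P.step vR ⟨PPos.moving v q' PDir.bwd, S', par'⟩ =
        P.leave v q PDir.bwd S' par' := by
      simp [step, leave, hvR, hq', hpar']
    have hsub : insert v S ⊆ S' := h.1
    refine ⟨S', par', hsub (Finset.mem_insert_self v S),
      ((h.trans (explores_of_step hexit rfl rfl)).of_insert hv hstep rfl hupd
        fun x hx => ?_).mono (by push_cast [show 2 ≤ P.deg v by omega]; linarith)⟩
    change x ∈ S'
    rw [← P.dest_port hx]
    obtain ⟨i, hi, hip⟩ := exists_add_mod_eq (a := q + 1) (P.port_lt hx)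
    rw [← hip]
    by_cases hilt : i < P.deg v - 2 + 1
    · simpa using hd' i hilt
    · rw [show q + 1 + i = q + P.deg v by omega, Nat.add_mod_right, Nat.mod_eq_of_lt hq]
      exact hsub (Finset.mem_insert_of_mem hd)

theorem trace_eq_iterate (P : PortedGraph V) (vR : V) (t : ℕ) :
    P.trace vR t = (P.step vR)^[t] (P.trace vR 0) := by
  induction t with
  | zero => rfl
  | succ t ih => rw [Function.iterate_succ_apply', ← ih, trace]

theorem eq_univ_of_adj_closed (P : PortedGraph V) {S : Finset V} {r : V} (hr : r ∈ S)
    (hS : ∀ w ∈ S, ∀ x, P.G.Adj w x → x ∈ S) : S = Finset.univ := by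
  refine Finset.eq_univ_of_forall fun x => ?_
  obtain ⟨p⟩ := P.conn.preconnected r x
  induction p with
  | nil => exact hr
  | cons hadj _ ih => exact ih (hS _ hr _ hadj)

theorem exists_explores_halted (P : PortedGraph V) (vR : V) :
    ∃ S par, (∀ x, P.G.Adj vR x → x ∈ S) ∧
      P.Explores vR (P.trace vR 0) ⟨PPos.halted vR, S, par⟩ (2 * P.deg vR + 1) := by
  rcases Nat.eq_zero_or_pos (P.deg vR) with h0 | hpos
  · refine ⟨{vR}, fun _ => 0, fun x hx => absurd (P.port_lt hx) (by omega), ?_⟩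
    have hstep : P.step vR (P.trace vR 0) = ⟨PPos.halted vR, {vR}, fun _ => 0⟩ := by
      simp [trace, step, h0]
    exact (explores_of_step hstep rfl rfl).mono (by simp)
  · have hstart : P.step vR (P.trace vR 0) = P.leave vR 0 PDir.fwd {vR} fun _ => 0 := by
      simp [trace, step, leave, hpos]
    have hlast (par : V → ℕ) : lastPort vR par vR = 0 := by simp [lastPort]
    obtain ⟨q, S, par, hq, hd, h⟩ := explores_from_port (S := {vR}) (k := P.deg vR - 1)
      (fun S hS => P.toursNew vR S (by simpa using hS)) (fun _ => 0) (by simp) hpos (by omega) (by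
        rw [hlast, show 0 + 1 + (P.deg vR - 1) = P.deg vR by omega, Nat.mod_self])
    rw [hlast] at hq
    have hhalt : P.step vR ⟨PPos.moving vR q PDir.bwd, S, par⟩ = ⟨PPos.halted vR, S, par⟩ := by
      simp [step, hq]
    refine ⟨S, par, fun x hx => ?_, (((explores_of_step hstart rfl rfl).trans h).trans
      (explores_of_step hhalt rfl rfl)).mono (by push_cast [show 1 ≤ P.deg vR by omega]; linarith)⟩
    have hlt := P.port_lt hx
    have := hd (P.port vR x) (by omega)
    rwa [zero_add, Nat.mod_eq_of_lt hlt, P.dest_port hx] at this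

end PortedGraph

/-- For every finite connected simple port-labeled graph `G` with `m`
edges and every root vertex `v_R`, the port-DFS traversal of `G` from `v_R` halts
at `v_R` after at most `4·m` moves (a halted state after `T` transitions
corresponds to `T - 1` moves, the transition into the halted position not being a
move), and at the moment it halts every vertex of `G` has been visited. -/
theorem statement0 {V : Type} [Fintype V] [DecidableEq V]
    (P : PortedGraph V) (vR : V) :
    ∃ T : ℕ, T ≤ 4 * P.G.edgeSet.ncard + 1 ∧
      (P.trace vR T).pos = PPos.halted vR ∧
      (P.trace vR T).vis = Finset.univ := by
  obtain ⟨S, par, hroot, hsub, -, hcl, T, hT, hc⟩ := P.exists_explores_halted vR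
  have hS : S = Finset.univ := by
    refine P.eq_univ_of_adj_closed (hsub (Finset.mem_singleton_self vR)) fun w hw x hx => ?_
    by_cases hwR : w = vR
    · exact hroot x (hwR ▸ hx)
    · exact hcl w hw (by simpa [PortedGraph.trace] using hwR) x hx
  rw [← PortedGraph.trace_eq_iterate] at hT
  refine ⟨T, ?_, by rw [hT], by rw [hT, hS]⟩
  have hsum := P.sum_deg_le
  simp only [PortedGraph.trace, Finset.sum_singleton, hS] at hc
  zify at hsum ⊢
  linarith
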